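/- With K = ℚ, c = 2, and F = F^{OI,1} ⊕ F^{OI,1}, let f = x_{1,2}x_{1,1}·e_{π,1} + x_{2,2}x_{2,1}·e_{ρ,2} ∈ F_2 (with π: [1] → [2] given by 1 ↦ 2 and ρ: [1] → [2] given by 1 ↦ 1) and let g = x_{2,3}x_{2,2}x_{1,1}·e_{σ1,2} − x_{2,3}x_{2,1}x_{1,2}·e_{σ2,2} ∈ F_3 (with σ1, σ2: [1] → [3] given by 1 ↦ 2 and 1 ↦ 1 respectively). Let G = F^{OI,2} ⊕ F^{OI,3} with basis elements d_{id[2],1}, d_{id[3],2}, and for each n let φ_n: G_n → F_n be the P_n-linear map determined by d_{τ,1} ↦ F(τ)(f) for τ ∈ Hom(2,n) and d_{υ,2} ↦ F(υ)(g) for υ ∈ Hom(3,n). Then for every natural number n, the kernel of φ_n equals the P_n-submodule of G_n generated by all images G(ε)(s_i), where s_1 = x_{1,2}·d_{τ1,1} − x_{1,1}·d_{τ2,1} + d_{id[3],2} ∈ G_3 (τ1, τ2: [2] → [3] with images {1,3} and {2,3}), s_2 = x_{2,4}·d_{π3,2} − x_{2,3}·d_{π4,2} ∈ G_4, s_3 =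 x_{1,2}·d_{π5,2} − x_{1,1}·d_{π6,2} − x_{1,3}·d_{π4,2} ∈ G_4 (π3, π4, π5, π6: [3] → [4] with images {1,2,3}, {1,2,4}, {1,3,4}, {2,3,4}), and ε ranges over all strictly increasing maps from the width of s_i into [n]. -/

import Mathlib

noncomputable section

open MvPolynomial

/-- `P_n = ℚ[x_{i,j} : 1 ≤ i ≤ 2, 1 ≤ j ≤ n]`, the width-`n` component of the
polynomial OI-algebra `P^2` over `ℚ`. -/
abbrev P (n : ℕ) := MvPolynomial (Fin 2 × Fin n) ℚ

/-- The variable `x_{i+1,j+1}` of `P_n` (zero-indexed). -/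
def x {n : ℕ} (i : Fin 2) (j : Fin n) : P n := X (i, j)

/-- Index set for the basis of the width-`n` component of `F = F^{OI,1} ⊕ F^{OI,1}`:
a copy of `Hom(1,n)` for each summand. -/
abbrev Idx (n : ℕ) := (Fin 1 ↪o Fin n) ⊕ (Fin 1 ↪o Fin n)

/-- The width-`n` component `F_n` of `F = F^{OI,1} ⊕ F^{OI,1}`, the free `P_n`-module
with basis `e_{π,1}, e_{π,2}` for `π ∈ Hom(1,n)`. -/
abbrev FF (n : ℕ) := Idx n →₀ P n

/-- Basis element `e_{π,1}` of `F_n`. -/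
def e1 {n : ℕ} (π : Fin 1 ↪o Fin n) : FF n := Finsupp.single (Sum.inl π) 1
/-- Basis element `e_{π,2}` of `F_n`. -/
def e2 {n : ℕ} (π : Fin 1 ↪o Fin n) : FF n := Finsupp.single (Sum.inr π) 1

/-- The structure map `F(ε) : F_m → F_n`, sending `a·e_{π,i}` to `ε_*(a)·e_{ε∘π,i}`. -/
def Fmap {m n : ℕ} (ε : Fin m ↪o Fin n) (v : FF m) : FF n :=
  v.sum fun i a =>
    Finsupp.single
      (Sum.map (fun π => π.trans ε) (fun π => π.trans ε) i)
      (rename (Prod.map id ⇑ε) a)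

/-- `π : [1] → [2]`, `1 ↦ 2`. -/
def π : Fin 1 ↪o Fin 2 := Finset.orderEmbOfFin ({1} : Finset (Fin 2)) (by decide)
/-- `ρ : [1] → [2]`, `1 ↦ 1`. -/
def ρ : Fin 1 ↪o Fin 2 := Finset.orderEmbOfFin ({0} : Finset (Fin 2)) (by decide)
/-- `σ1 : [1] → [3]`, `1 ↦ 2`. -/
def σ1 : Fin 1 ↪o Fin 3 := Finset.orderEmbOfFin ({1} : Finset (Fin 3)) (by decide)
/-- `σ2 : [1] → [3]`, `1 ↦ 1`. -/
def σ2 : Fin 1 ↪o Fin 3 := Finset.orderEmbOfFin ({0} : Finset (Fin 3)) (by decide)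

/-- `f = x_{1,2}x_{1,1}·e_{π,1} + x_{2,2}x_{2,1}·e_{ρ,2} ∈ F_2`. -/
def f : FF 2 := (x 0 1 * x 0 0 : P 2) • e1 π + (x 1 1 * x 1 0 : P 2) • e2 ρ

/-- `g = x_{2,3}x_{2,2}x_{1,1}·e_{σ1,2} − x_{2,3}x_{2,1}x_{1,2}·e_{σ2,2} ∈ F_3`. -/
def g : FF 3 :=
  (x 1 2 * x 1 1 * x 0 0 : P 3) • e2 σ1 - (x 1 2 * x 1 0 * x 0 1 : P 3) • e2 σ2

/-- Index set for the basis of the width-`n` component of `G = F^{OI,2} ⊕ F^{OI,3}`. -/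
abbrev JIdx (n : ℕ) := (Fin 2 ↪o Fin n) ⊕ (Fin 3 ↪o Fin n)

/-- The width-`n` component `G_n` of `G = F^{OI,2} ⊕ F^{OI,3}`, the free `P_n`-module with
basis `d_{τ,1} (τ ∈ Hom(2,n))` and `d_{υ,2} (υ ∈ Hom(3,n))`. -/
abbrev GG (n : ℕ) := JIdx n →₀ P n

/-- Basis element `d_{τ,1}` of `G_n`. -/
def d1 {n : ℕ} (τ : Fin 2 ↪o Fin n) : GG n := Finsupp.single (Sum.inl τ) 1
/-- Basis element `d_{υ,2}` of `G_n`. -/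
def d2 {n : ℕ} (υ : Fin 3 ↪o Fin n) : GG n := Finsupp.single (Sum.inr υ) 1

/-- The structure map `G(ε) : G_m → G_n`, sending `a·d_{π,i}` to `ε_*(a)·d_{ε∘π,i}`. -/
def Gmap {m n : ℕ} (ε : Fin m ↪o Fin n) (v : GG m) : GG n :=
  v.sum fun i a =>
    Finsupp.single
      (Sum.map (fun τ => τ.trans ε) (fun υ => υ.trans ε) i)
      (rename (Prod.map id ⇑ε) a)

/-- The `P_n`-linear map `φ_n : G_n → F_n` determined by `d_{τ,1} ↦ F(τ)(f)` for
`τ ∈ Hom(2,n)` and `d_{υ,2} ↦ F(υ)(g)` for `υ ∈ Hom(3,n)`. -/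
def phi (n : ℕ) : GG n →ₗ[P n] FF n :=
  Finsupp.lsum ℕ fun j =>
    LinearMap.toSpanSingleton (P n) (FF n)
      (Sum.elim (fun τ => Fmap τ f) (fun υ => Fmap υ g) j)

/-- `τ1 : [2] → [3]` with image `{1,3}`. -/
def τ1 : Fin 2 ↪o Fin 3 := Finset.orderEmbOfFin ({0, 2} : Finset (Fin 3)) (by decide)
/-- `τ2 : [2] → [3]` with image `{2,3}`. -/
def τ2 : Fin 2 ↪o Fin 3 := Finset.orderEmbOfFin ({1, 2} : Finset (Fin 3)) (by decide)
/-- `id_{[3]} : [3] → [3]`. -/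
def id3 : Fin 3 ↪o Fin 3 := Finset.orderEmbOfFin (Finset.univ : Finset (Fin 3)) (by decide)
/-- `π3 : [3] → [4]` with image `{1,2,3}`. -/
def π3 : Fin 3 ↪o Fin 4 := Finset.orderEmbOfFin ({0, 1, 2} : Finset (Fin 4)) (by decide)
/-- `π4 : [3] → [4]` with image `{1,2,4}`. -/
def π4 : Fin 3 ↪o Fin 4 := Finset.orderEmbOfFin ({0, 1, 3} : Finset (Fin 4)) (by decide)
/-- `π5 : [3] → [4]` with image `{1,3,4}`. -/
def π5 : Fin 3 ↪o Fin 4 := Finset.orderEmbOfFin ({0, 2, 3} : Finset (Fin 4)) (by decide)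
/-- `π6 : [3] → [4]` with image `{2,3,4}`. -/
def π6 : Fin 3 ↪o Fin 4 := Finset.orderEmbOfFin ({1, 2, 3} : Finset (Fin 4)) (by decide)

/-- `s1 = x_{1,2}·d_{τ1,1} − x_{1,1}·d_{τ2,1} + d_{id[3],2} ∈ G_3`. -/
def s1 : GG 3 := (x 0 1 : P 3) • d1 τ1 - (x 0 0 : P 3) • d1 τ2 + d2 id3
/-- `s2 = x_{2,4}·d_{π3,2} − x_{2,3}·d_{π4,2} ∈ G_4`. -/
def s2 : GG 4 := (x 1 3 : P 4) • d2 π3 - (x 1 2 : P 4) • d2 π4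
/-- `s3 = x_{1,2}·d_{π5,2} − x_{1,1}·d_{π6,2} − x_{1,3}·d_{π4,2} ∈ G_4`. -/
def s3 : GG 4 := (x 0 1 : P 4) • d2 π5 - (x 0 0 : P 4) • d2 π6 - (x 0 2 : P 4) • d2 π4

/-- The order embedding `[1] → [n]` with image `{j}`. -/
def emb1 {n : ℕ} (j : Fin n) : Fin 1 ↪o Fin n :=
  OrderEmbedding.ofStrictMono (fun _ => j) (by intro a b h; omega)

/-- The order embedding `[2] → [n]` with image `{i,j}`. -/
def emb2 {n : ℕ} (i j : Fin n) (h : i < j) : Fin 2 ↪o Fin n :=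
  OrderEmbedding.ofStrictMono ![i, j] (by
    rw [Fin.strictMono_iff_lt_succ]; intro a; fin_cases a; simpa using h)

/-- The order embedding `[4] → [n]` with image `{i,m,k,l}`. -/
def emb4 {n : ℕ} (i m k l : Fin n) (h1 : i < m) (h2 : m < k) (h3 : k < l) : Fin 4 ↪o Fin n :=
  OrderEmbedding.ofStrictMono ![i, m, k, l] (by
    rw [Fin.strictMono_iff_lt_succ]; intro a; fin_cases a <;> simp [h1, h2, h3])

/-- `d_{(i,j),1}` for `i < j`, zero otherwise. -/
def DD {n : ℕ} (i j : Fin n) : GG n := if h : i < j then d1 (emb2 i j h) else 0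

theorem d1_eq_DD {n : ℕ} (τ : Fin 2 ↪o Fin n) : d1 τ = DD (τ 0) (τ 1) := by
  have h : τ 0 < τ 1 := τ.strictMono (by decide)
  rw [DD, dif_pos h]
  congr 1
  ext a
  fin_cases a <;> rfl

theorem emb1_eq {n : ℕ} (τ : Fin 1 ↪o Fin n) : τ = emb1 (τ 0) := by
  ext a
  fin_cases a; rfl

theorem emb1_inj {n : ℕ} {i j : Fin n} : emb1 i = emb1 j ↔ i = j := by
  constructor
  · intro h
    exact congrArg (fun τ => τ 0) h
  · rintro rfl; rfl

theorem pi_coe : (π : Fin 1 → Fin 2) = ![1] :=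
  (Finset.orderEmbOfFin_unique _ (by decide) (by decide)).symm
theorem rho_coe : (ρ : Fin 1 → Fin 2) = ![0] :=
  (Finset.orderEmbOfFin_unique _ (by decide) (by decide)).symm
theorem sigma1_coe : (σ1 : Fin 1 → Fin 3) = ![1] :=
  (Finset.orderEmbOfFin_unique _ (by decide) (by decide)).symm
theorem sigma2_coe : (σ2 : Fin 1 → Fin 3) = ![0] :=
  (Finset.orderEmbOfFin_unique _ (by decide) (by decide)).symm
theorem tau1_coe : (τ1 : Fin 2 → Fin 3) = ![0, 2] :=
  (Finset.orderEmbOfFin_unique _ (by decide) (by decide)).symm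
theorem tau2_coe : (τ2 : Fin 2 → Fin 3) = ![1, 2] :=
  (Finset.orderEmbOfFin_unique _ (by decide) (by decide)).symm
theorem id3_coe : (id3 : Fin 3 → Fin 3) = ![0, 1, 2] :=
  (Finset.orderEmbOfFin_unique _ (by decide) (by decide)).symm
theorem pi3_coe : (π3 : Fin 3 → Fin 4) = ![0, 1, 2] :=
  (Finset.orderEmbOfFin_unique _ (by decide) (by decide)).symm
theorem pi4_coe : (π4 : Fin 3 → Fin 4) = ![0, 1, 3] :=
  (Finset.orderEmbOfFin_unique _ (by decide) (by decide)).symm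
theorem pi5_coe : (π5 : Fin 3 → Fin 4) = ![0, 2, 3] :=
  (Finset.orderEmbOfFin_unique _ (by decide) (by decide)).symm
theorem pi6_coe : (π6 : Fin 3 → Fin 4) = ![1, 2, 3] :=
  (Finset.orderEmbOfFin_unique _ (by decide) (by decide)).symm

theorem Fmap_add {m n : ℕ} (ε : Fin m ↪o Fin n) (v w : FF m) :
    Fmap ε (v + w) = Fmap ε v + Fmap ε w := by
  unfold Fmap
  apply Finsupp.sum_add_index' <;> simp

theorem Fmap_sub {m n : ℕ} (ε : Fin m ↪o Fin n) (v w : FF m) :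
    Fmap ε (v - w) = Fmap ε v - Fmap ε w := by
  rw [eq_sub_iff_add_eq, ← Fmap_add, sub_add_cancel]

theorem Fmap_e1 {m n : ℕ} (ε : Fin m ↪o Fin n) (a : P m) (τ : Fin 1 ↪o Fin m) :
    Fmap ε (a • e1 τ) = rename (Prod.map id ⇑ε) a • e1 (emb1 (ε (τ 0))) := by
  rw [← show τ.trans ε = emb1 (ε (τ 0)) from emb1_eq _]
  simp [Fmap, e1, Finsupp.smul_single]

theorem Fmap_e2 {m n : ℕ} (ε : Fin m ↪o Fin n) (a : P m) (τ : Fin 1 ↪o Fin m) :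
    Fmap ε (a • e2 τ) = rename (Prod.map id ⇑ε) a • e2 (emb1 (ε (τ 0))) := by
  rw [← show τ.trans ε = emb1 (ε (τ 0)) from emb1_eq _]
  simp [Fmap, e2, Finsupp.smul_single]

theorem Gmap_add {m n : ℕ} (ε : Fin m ↪o Fin n) (v w : GG m) :
    Gmap ε (v + w) = Gmap ε v + Gmap ε w := by
  unfold Gmap
  apply Finsupp.sum_add_index' <;> simp

theorem Gmap_sub {m n : ℕ} (ε : Fin m ↪o Fin n) (v w : GG m) :
    Gmap ε (v - w) = Gmap ε v - Gmap ε w := by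
  rw [eq_sub_iff_add_eq, ← Gmap_add, sub_add_cancel]

theorem Gmap_d1 {m n : ℕ} (ε : Fin m ↪o Fin n) (a : P m) (τ : Fin 2 ↪o Fin m) :
    Gmap ε (a • d1 τ) = rename (Prod.map id ⇑ε) a • DD (ε (τ 0)) (ε (τ 1)) := by
  rw [← show d1 (τ.trans ε) = DD (ε (τ 0)) (ε (τ 1)) from d1_eq_DD _]
  simp [Gmap, d1, Finsupp.smul_single]

theorem Gmap_d2 {m n : ℕ} (ε : Fin m ↪o Fin n) (a : P m) (τ : Fin 3 ↪o Fin m) :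
    Gmap ε (a • d2 τ) = rename (Prod.map id ⇑ε) a • d2 (τ.trans ε) := by
  simp [Gmap, d2, Finsupp.smul_single]

theorem Gmap_s1 {n : ℕ} (ε : Fin 3 ↪o Fin n) :
    Gmap ε s1 = x 0 (ε 1) • DD (ε 0) (ε 2) - x 0 (ε 0) • DD (ε 1) (ε 2) + d2 ε := by
  have h : id3.trans ε = ε := by
    ext a
    simp only [RelEmbedding.coe_trans, Function.comp, id3_coe]
    fin_cases a <;> rfl
  have := Gmap_d2 ε 1 id3
  rw [one_smul, map_one, one_smul, h] at this
  rw [s1, Gmap_add, Gmap_sub, Gmap_d1, Gmap_d1, this, tau1_coe, tau2_coe]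
  simp [x]

theorem Gmap_s2 {n : ℕ} (ε : Fin 4 ↪o Fin n) :
    Gmap ε s2 = x 1 (ε 3) • d2 (π3.trans ε) - x 1 (ε 2) • d2 (π4.trans ε) := by
  rw [s2, Gmap_sub, Gmap_d2, Gmap_d2]
  simp [x]

theorem Gmap_s3 {n : ℕ} (ε : Fin 4 ↪o Fin n) :
    Gmap ε s3 = x 0 (ε 1) • d2 (π5.trans ε) - x 0 (ε 0) • d2 (π6.trans ε)
      - x 0 (ε 2) • d2 (π4.trans ε) := by
  rw [s3, Gmap_sub, Gmap_sub, Gmap_d2, Gmap_d2, Gmap_d2]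
  simp [x]

theorem phi_d1 {n : ℕ} (τ : Fin 2 ↪o Fin n) : phi n (d1 τ) =
    (x 0 (τ 1) * x 0 (τ 0)) • e1 (emb1 (τ 1)) + (x 1 (τ 1) * x 1 (τ 0)) • e2 (emb1 (τ 0)) := by
  have : phi n (d1 τ) = Fmap τ f := by simp [phi, d1]
  rw [this, f, Fmap_add, Fmap_e1, Fmap_e2, pi_coe, rho_coe]
  simp [x]

theorem phi_DD {n : ℕ} {i j : Fin n} (h : i < j) : phi n (DD i j) =
    (x 0 j * x 0 i) • e1 (emb1 j) + (x 1 j * x 1 i) • e2 (emb1 i) := by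
  rw [DD, dif_pos h, phi_d1]
  rfl

theorem phi_d2 {n : ℕ} (υ : Fin 3 ↪o Fin n) : phi n (d2 υ) =
    (x 1 (υ 2) * x 1 (υ 1) * x 0 (υ 0)) • e2 (emb1 (υ 1))
      - (x 1 (υ 2) * x 1 (υ 0) * x 0 (υ 1)) • e2 (emb1 (υ 0)) := by
  have : phi n (d2 υ) = Fmap υ g := by simp [phi, d2]
  rw [this, g, Fmap_sub, Fmap_e2, Fmap_e2, sigma1_coe, sigma2_coe]
  simp [x]

/-- The span of the syzygies. -/
def SS (n : ℕ) : Submodule (P n) (GG n) := Submodule.span (P n)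
      ({v | ∃ ε : Fin 3 ↪o Fin n, v = Gmap ε s1} ∪
        {v | ∃ ε : Fin 4 ↪o Fin n, v = Gmap ε s2} ∪
        {v | ∃ ε : Fin 4 ↪o Fin n, v = Gmap ε s3})

theorem SS_le (n : ℕ) : SS n ≤ LinearMap.ker (phi n) := by
  rw [SS, Submodule.span_le]
  rintro v ((⟨ε, rfl⟩ | ⟨ε, rfl⟩) | ⟨ε, rfl⟩)
  · have h1 : ε 0 < ε 2 := ε.strictMono (by decide)
    have h2 : ε 1 < ε 2 := ε.strictMono (by decide)
    simp only [SetLike.mem_coe, LinearMap.mem_ker, Gmap_s1, map_add, map_sub, map_smul,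
      phi_DD h1, phi_DD h2, phi_d2]
    module
  · simp only [SetLike.mem_coe, LinearMap.mem_ker, Gmap_s2, map_sub, map_smul, phi_d2,
      RelEmbedding.coe_trans, Function.comp, pi3_coe, pi4_coe]
    simp
    module
  · simp only [SetLike.mem_coe, LinearMap.mem_ker, Gmap_s3, map_sub, map_smul, phi_d2,
      RelEmbedding.coe_trans, Function.comp, pi5_coe, pi4_coe, pi6_coe]
    simp
    module

theorem s1_mem {n : ℕ} (ε : Fin 3 ↪o Fin n) :
    x 0 (ε 1) • DD (ε 0) (ε 2) - x 0 (ε 0) • DD (ε 1) (ε 2) + d2 ε ∈ SS n :=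
  Submodule.subset_span (Or.inl (Or.inl ⟨ε, (Gmap_s1 ε).symm⟩))

theorem quad_mem {n : ℕ} {i m k l : Fin n} (h1 : i < m) (h2 : m < k) (h3 : k < l) :
    (x 1 l * x 0 i) • DD m k - (x 1 l * x 0 m) • DD i k - (x 1 k * x 0 i) • DD m l
      + (x 1 k * x 0 m) • DD i l ∈ SS n := by
  set ε := emb4 i m k l h1 h2 h3 with hε
  have a0 : ε 0 = i := rfl
  have a1 : ε 1 = m := rfl
  have a2 : ε 2 = k := rfl
  have a3 : ε 3 = l := rfl
  have hA := s1_mem (π3.trans ε)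
  have hB := s1_mem (π4.trans ε)
  have hC : x 1 (ε 3) • d2 (π3.trans ε) - x 1 (ε 2) • d2 (π4.trans ε) ∈ SS n :=
    Submodule.subset_span (Or.inl (Or.inr ⟨ε, (Gmap_s2 ε).symm⟩))
  have b0 : (π3.trans ε) 0 = i := by simp [pi3_coe, a0]
  have b1 : (π3.trans ε) 1 = m := by simp [pi3_coe, a1]
  have b2 : (π3.trans ε) 2 = k := by simp [pi3_coe, a2]
  have c0 : (π4.trans ε) 0 = i := by simp [pi4_coe, a0]
  have c1 : (π4.trans ε) 1 = m := by simp [pi4_coe, a1]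
  have c2 : (π4.trans ε) 2 = l := by simp [pi4_coe, a3]
  rw [b0, b1, b2] at hA
  rw [c0, c1, c2] at hB
  rw [a2, a3] at hC
  have := (SS n).add_mem ((SS n).sub_mem hC ((SS n).smul_mem (x 1 l) hA))
    ((SS n).smul_mem (x 1 k) hB)
  convert this using 1
  module

/-- The linear combination of the `d_{(i,j),1}` with coefficients `c`. -/
def TT (n : ℕ) : (Fin n × Fin n → P n) →ₗ[P n] GG n :=
  Fintype.linearCombination (P n) (fun p : Fin n × Fin n => DD p.1 p.2)

theorem TT_single {n : ℕ} (i j : Fin n) (a : P n) :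
    TT n (Pi.single (i, j) a) = a • DD i j := by
  simp [TT]

/-- Strict upper triangularity. -/
def Tri {n : ℕ} (c : Fin n × Fin n → P n) : Prop := ∀ i j, ¬ i < j → c (i, j) = 0

theorem phi_TT {n : ℕ} (c : Fin n × Fin n → P n) (hc : Tri c) : phi n (TT n c) =
    ∑ i, ∑ j, c (i, j) • ((x 0 j * x 0 i) • e1 (emb1 j) + (x 1 j * x 1 i) • e2 (emb1 i)) := by
  rw [TT, Fintype.linearCombination_apply, map_sum, Fintype.sum_prod_type]
  refine Finset.sum_congr rfl fun i _ => Finset.sum_congr rfl fun j _ => ?_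
  rw [map_smul]
  by_cases h : i < j
  · rw [phi_DD h]
  · rw [hc i j h, zero_smul, zero_smul]

theorem col_eq {n : ℕ} (c : Fin n × Fin n → P n) (hc : Tri c) (hk : phi n (TT n c) = 0)
    (j : Fin n) : ∑ i, X (0, i) * c (i, j) = 0 := by
  have h := DFunLike.congr_fun hk (Sum.inl (emb1 j))
  rw [phi_TT c hc] at h
  simp [Finsupp.finsetSum_apply, e1, e2, Finsupp.single_apply, emb1_inj] at h
  have h2 : (X (0, j) : P n) * ∑ i, X (0, i) * c (i, j) = 0 := by
    rw [← h, Finset.mul_sum]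
    refine Finset.sum_congr rfl fun i _ => ?_
    simp only [x]; ring
  exact (mul_eq_zero.mp h2).resolve_left (X_ne_zero _)

theorem row_eq {n : ℕ} (c : Fin n × Fin n → P n) (hc : Tri c) (hk : phi n (TT n c) = 0)
    (i : Fin n) : ∑ j, X (1, j) * c (i, j) = 0 := by
  have h := DFunLike.congr_fun hk (Sum.inr (emb1 i))
  rw [phi_TT c hc, Finset.sum_comm] at h
  simp [Finsupp.finsetSum_apply, e1, e2, Finsupp.single_apply, emb1_inj] at h
  have h2 : (X (1, i) : P n) * ∑ j, X (1, j) * c (i, j) = 0 := by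
    rw [← h, Finset.mul_sum]
    refine Finset.sum_congr rfl fun i _ => ?_
    simp only [x]; ring
  exact (mul_eq_zero.mp h2).resolve_left (X_ne_zero _)

theorem supp_lemma {n : ℕ} (r : Fin 2) (c : Fin n → P n) (h : ∑ j, X (r, j) * c j = 0)
    (l : Fin n) (μ : (Fin 2 × Fin n) →₀ ℕ) (hμ : μ ∈ (c l).support) :
    ∃ k, k ≠ l ∧ c k ≠ 0 ∧ μ (r, k) ≠ 0 := by
  by_contra! hcon
  rw [mem_support_iff] at hμ
  apply hμ
  have h1 := congrArg (coeff (Finsupp.single (r, l) 1 + μ)) h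
  rw [coeff_sum, Finset.sum_eq_single l, coeff_X_mul, coeff_zero] at h1
  · exact h1
  · intro k _ hkl
    by_cases hck : c k = 0
    · simp [hck]
    · rw [coeff_X_mul', if_neg]
      have := hcon k hkl hck
      simp [Finsupp.single_apply, this, hkl.symm]
  · simp

theorem elim_lemma {n : ℕ} (m l : Fin n) (p : P n)
    (hp : p ∈ Ideal.span (Set.image (fun s => monomial s (1 : ℚ))
      {s : (Fin 2 × Fin n) →₀ ℕ | ∃ i k, i < m ∧ m < k ∧ k < l ∧
        s = Finsupp.single (0, i) 1 + Finsupp.single (1, k) 1})) :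
    ∃ q : Fin n × Fin n → P n, TT n q ∈ SS n ∧ Tri q ∧ q (m, l) = p ∧
      (∀ i j, m < i → q (i, j) = 0) ∧ (∀ j, l < j → q (m, j) = 0) := by
  induction hp using Submodule.span_induction with
  | mem p hp =>
    obtain ⟨s, ⟨i, k, h1, h2, h3, rfl⟩, rfl⟩ := hp
    have e : monomial (Finsupp.single (0, i) 1 + Finsupp.single (1, k) 1) (1 : ℚ)
        = (x 0 i * x 1 k : P n) := by
      simp [x, X, monomial_mul]
    refine ⟨Pi.single (m, l) (x 1 k * x 0 i) + Pi.single (i, k) (x 1 l * x 0 m)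
      - Pi.single (m, k) (x 1 l * x 0 i) - Pi.single (i, l) (x 1 k * x 0 m), ?_, ?_, ?_, ?_, ?_⟩
    · simp only [map_sub, map_add, TT_single]
      convert (SS n).neg_mem (quad_mem h1 h2 h3) using 1
      module
    · intro a b hab
      have z1 : ¬ ((a, b) = (m, l)) := by rintro ⟨⟩; omega
      have z2 : ¬ ((a, b) = (i, k)) := by rintro ⟨⟩; omega
      have z3 : ¬ ((a, b) = (m, k)) := by rintro ⟨⟩; omega
      have z4 : ¬ ((a, b) = (i, l)) := by rintro ⟨⟩; omega
      simp only [Pi.sub_apply, Pi.add_apply, Pi.single_apply, z1, z2, z3, z4, if_false]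
      simp
    · have z2 : ¬ ((m, l) = (i, k)) := by rintro ⟨⟩; omega
      have z3 : ¬ ((m, l) = (m, k)) := by rintro ⟨⟩; omega
      have z4 : ¬ ((m, l) = (i, l)) := by rintro ⟨⟩; omega
      simp only [Pi.sub_apply, Pi.add_apply, Pi.single_apply, z2, z3, z4, if_false]
      simp only [e]
      simp [mul_comm]
    · intro a b hab
      have z1 : ¬ ((a, b) = (m, l)) := by rintro ⟨⟩; omega
      have z2 : ¬ ((a, b) = (i, k)) := by rintro ⟨⟩; omega
      have z3 : ¬ ((a, b) = (m, k)) := by rintro ⟨⟩; omega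
      have z4 : ¬ ((a, b) = (i, l)) := by rintro ⟨⟩; omega
      simp only [Pi.sub_apply, Pi.add_apply, Pi.single_apply, z1, z2, z3, z4, if_false]
      simp
    · intro b hab
      have z1 : ¬ ((m, b) = (m, l)) := by rintro ⟨⟩; omega
      have z2 : ¬ ((m, b) = (i, k)) := by rintro ⟨⟩; omega
      have z3 : ¬ ((m, b) = (m, k)) := by rintro ⟨⟩; omega
      have z4 : ¬ ((m, b) = (i, l)) := by rintro ⟨⟩; omega
      simp only [Pi.sub_apply, Pi.add_apply, Pi.single_apply, z1, z2, z3, z4, if_false]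
      simp
  | zero =>
    exact ⟨0, by simp, fun _ _ _ => rfl, rfl, fun _ _ _ => rfl, fun _ _ => rfl⟩
  | add p p' _ _ hp hp' =>
    obtain ⟨q, a1, a2, a3, a4, a5⟩ := hp
    obtain ⟨q', b1, b2, b3, b4, b5⟩ := hp'
    refine ⟨q + q', ?_, ?_, ?_, ?_, ?_⟩
    · rw [map_add]; exact (SS n).add_mem a1 b1
    · intro i j h; simp [a2 i j h, b2 i j h]
    · simp [a3, b3]
    · intro i j h; simp [a4 i j h, b4 i j h]
    · intro j h; simp [a5 j h, b5 j h]
  | smul a p _ hp =>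
    obtain ⟨q, a1, a2, a3, a4, a5⟩ := hp
    refine ⟨a • q, ?_, ?_, ?_, ?_, ?_⟩
    · rw [map_smul]; exact (SS n).smul_mem a a1
    · intro i j h; simp [a2 i j h]
    · simp [a3]
    · intro i j h; simp [a4 i j h]
    · intro j h; simp [a5 j h]

theorem main_ind {n : ℕ} (M : ℕ) : ∀ c : Fin n × Fin n → P n, Tri c → phi n (TT n c) = 0 →
    (∀ i j : Fin n, M ≤ i → c (i, j) = 0) → TT n c ∈ SS n := by
  induction M with
  | zero =>
    intro c _ _ h
    have : c = 0 := by ext1 ⟨i, j⟩; exact h i j (Nat.zero_le _)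
    simp [this]
  | succ M ihM =>
    have key : ∀ L : ℕ, ∀ c : Fin n × Fin n → P n, Tri c → phi n (TT n c) = 0 →
        (∀ i j : Fin n, M + 1 ≤ i → c (i, j) = 0) →
        (∀ i j : Fin n, (i : ℕ) = M → L ≤ j → c (i, j) = 0) → TT n c ∈ SS n := by
      intro L
      induction L with
      | zero =>
        intro c hc hk h1 h2
        refine ihM c hc hk fun i j hi => ?_
        rcases Nat.eq_or_lt_of_le hi with h | h
        · exact h2 i j h.symm (Nat.zero_le _)
        · exact h1 i j h
      | succ L ihL =>
        intro c hc hk h1 h2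
        by_cases hM : M < n ∧ L < n
        · obtain ⟨hM, hL⟩ := hM
          let m : Fin n := ⟨M, hM⟩
          let l : Fin n := ⟨L, hL⟩
          have hr := row_eq c hc hk m
          have hcl := col_eq c hc hk l
          obtain ⟨q, q1, q2, q3, q4, q5⟩ := elim_lemma m l (c (m, l)) (by
            rw [mem_ideal_span_monomial_image]
            intro μ hμ
            obtain ⟨k, hk1, hk2, hk3⟩ := supp_lemma 1 (fun j => c (m, j)) hr l μ hμ
            obtain ⟨i, hi1, hi2, hi3⟩ := supp_lemma 0 (fun i => c (i, l)) hcl m μ hμ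
            have hmk : m < k := by
              by_contra hh; exact hk2 (hc _ _ hh)
            have hkl : k < l := by
              by_contra hh
              refine hk2 (h2 m k rfl ?_)
              have : l < k := lt_of_le_of_ne (not_lt.mp hh) hk1.symm
              exact this
            have him : i < m := by
              by_contra hh
              refine hi2 (h1 i l ?_)
              have : m < i := lt_of_le_of_ne (not_lt.mp hh) hi1.symm
              exact this
            refine ⟨_, ⟨i, k, him, hmk, hkl, rfl⟩, ?_⟩
            intro v
            have hik : ((0 : Fin 2), i) ≠ (1, k) := by simp
            simp only [Finsupp.add_apply, Finsupp.single_apply]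
            by_cases v1 : (0, i) = v
            · subst v1
              rw [if_pos rfl, if_neg hik.symm]
              omega
            · by_cases v2 : (1, k) = v
              · subst v2
                rw [if_pos rfl, if_neg v1]
                omega
              · rw [if_neg v1, if_neg v2]; omega)
          have hq : phi n (TT n q) = 0 := SS_le n q1
          have := ihL (c - q) (fun i j h => by simp [hc i j h, q2 i j h])
            (by rw [map_sub, map_sub, hk, hq, sub_zero])
            (fun i j h => by
              simp [h1 i j h, q4 i j (show M < i from h)])
            (fun i j hi hj => by
              obtain rfl : i = m := Fin.ext hi
              rcases Nat.eq_or_lt_of_le hj with h | h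
              · obtain rfl : j = l := Fin.ext h.symm
                simp [q3]
              · simp [h2 _ j hi h, q5 j h])
          have h3 := (SS n).add_mem this q1
          rwa [← map_add, sub_add_cancel] at h3
        · refine ihL c hc hk h1 fun i j hi hj => ?_
          refine h2 i j hi ?_
          have := i.2
          have := j.2
          omega
    intro c hc hk h
    exact key n c hc hk h fun i j _ hj => absurd j.2 (not_lt.mpr hj)

theorem reduce {n : ℕ} (v : GG n) : ∃ c, Tri c ∧ v - TT n c ∈ SS n := by
  induction v using Finsupp.induction_linear with
  | zero => exact ⟨0, fun _ _ _ => rfl, by simp⟩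
  | add v w hv hw =>
    obtain ⟨c, hc, h⟩ := hv
    obtain ⟨c', hc', h'⟩ := hw
    refine ⟨c + c', fun i j hh => by simp [hc i j hh, hc' i j hh], ?_⟩
    convert (SS n).add_mem h h' using 1
    rw [map_add]; abel
  | single s a =>
    rcases s with τ | υ
    · have h0 : τ 0 < τ 1 := τ.strictMono (by decide)
      refine ⟨Pi.single (τ 0, τ 1) a, ?_, ?_⟩
      · intro i j h
        rw [Pi.single_apply, if_neg]
        rintro ⟨⟩
        exact h h0
      · have : Finsupp.single (Sum.inl τ) a = a • d1 τ := by simp [d1]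
        rw [TT_single, this, d1_eq_DD, sub_self]
        exact (SS n).zero_mem
    · have h1 : υ 0 < υ 2 := υ.strictMono (by decide)
      have h2 : υ 1 < υ 2 := υ.strictMono (by decide)
      refine ⟨Pi.single (υ 1, υ 2) (a * x 0 (υ 0)) - Pi.single (υ 0, υ 2) (a * x 0 (υ 1)), ?_, ?_⟩
      · intro i j h
        rw [Pi.sub_apply, Pi.single_apply, if_neg, Pi.single_apply, if_neg, sub_zero]
        · rintro ⟨⟩
          exact h h1
        · rintro ⟨⟩
          exact h h2
      · have : Finsupp.single (Sum.inr υ) a = a • d2 υ := by simp [d2]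
        rw [map_sub, TT_single, TT_single, this]
        convert (SS n).smul_mem a (s1_mem υ) using 1
        module

/-- for every `n`, the kernel of `φ_n : G_n → F_n` equals the `P_n`-submodule
of `G_n` generated by all images `G(ε)(s1)`, `G(ε)(s2)`, `G(ε)(s3)` under the structure
maps of `G`, where `ε` ranges over all strictly increasing maps from the width of `s_i`
into `[n]`. -/
theorem ker_phi_eq_span_syzygies (n : ℕ) :
    LinearMap.ker (phi n) = Submodule.span (P n)
      ({v | ∃ ε : Fin 3 ↪o Fin n, v = Gmap ε s1} ∪
        {v | ∃ ε : Fin 4 ↪o Fin n, v = Gmap ε s2} ∪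
        {v | ∃ ε : Fin 4 ↪o Fin n, v = Gmap ε s3}) := by
  change LinearMap.ker (phi n) = SS n
  refine le_antisymm (fun v hv => ?_) (SS_le n)
  obtain ⟨c, hc, h⟩ := reduce v
  have h0 : phi n (v - TT n c) = 0 := SS_le n h
  have hv0 : phi n v = 0 := hv
  rw [map_sub, hv0, zero_sub, neg_eq_zero] at h0
  have h1 := main_ind n c hc h0 fun i _ hi => absurd i.2 (not_lt.mpr hi)
  have h2 := (SS n).add_mem h h1
  rwa [sub_add_cancel] at h2

end
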